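/- For every positive integer n there exists a prime number p in the interval [5n, 6n], i.e., with 5n ≤ p ≤ 6n. -/

import Mathlib

open Chebyshev ArithmeticFunction

/-- Small cases, by a descending chain of primes. -/
lemma small_case (n : ℕ) (hn : 0 < n) (h : n < 2 ^ 22) :
    ∃ p : ℕ, p.Prime ∧ 5 * n ≤ p ∧ p ≤ 6 * n := by
  by_contra hcon
  have H : ∀ p : ℕ, p.Prime → ¬ (5 * n ≤ p ∧ p ≤ 6 * n) := fun p hp hh => hcon ⟨p, hp, hh⟩
  have h : n ≤ 3606675 := by have := H 21640049 (by norm_num); omega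
  have h : n ≤ 3005564 := by have := H 18033377 (by norm_num); omega
  have h : n ≤ 2504636 := by have := H 15027821 (by norm_num); omega
  have h : n ≤ 2087200 := by have := H 12523183 (by norm_num); omega
  have h : n ≤ 1739338 := by have := H 10436003 (by norm_num); omega
  have h : n ≤ 1449449 := by have := H 8696693 (by norm_num); omega
  have h : n ≤ 1207874 := by have := H 7247249 (by norm_num); omega
  have h : n ≤ 1006564 := by have := H 6039373 (by norm_num); omega
  have h : n ≤ 838804 := by have := H 5032823 (by norm_num); omega
  have h : n ≤ 699015 := by have := H 4194023 (by norm_num); omega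
  have h : n ≤ 582515 := by have := H 3495077 (by norm_num); omega
  have h : n ≤ 485435 := by have := H 2912579 (by norm_num); omega
  have h : n ≤ 404529 := by have := H 2427179 (by norm_num); omega
  have h : n ≤ 337108 := by have := H 2022649 (by norm_num); omega
  have h : n ≤ 280923 := by have := H 1685543 (by norm_num); omega
  have h : n ≤ 234102 := by have := H 1404617 (by norm_num); omega
  have h : n ≤ 195085 := by have := H 1170511 (by norm_num); omega
  have h : n ≤ 162571 := by have := H 975427 (by norm_num); omega
  have h : n ≤ 135477 := by have := H 812857 (by norm_num); omega
  have h : n ≤ 112899 := by have := H 677387 (by norm_num); omega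
  have h : n ≤ 94085 := by have := H 564497 (by norm_num); omega
  have h : n ≤ 78406 := by have := H 470429 (by norm_num); omega
  have h : n ≤ 65338 := by have := H 392033 (by norm_num); omega
  have h : n ≤ 54449 := by have := H 326693 (by norm_num); omega
  have h : n ≤ 45374 := by have := H 272249 (by norm_num); omega
  have h : n ≤ 37813 := by have := H 226871 (by norm_num); omega
  have h : n ≤ 31515 := by have := H 189067 (by norm_num); omega
  have h : n ≤ 26264 := by have := H 157579 (by norm_num); omega
  have h : n ≤ 21886 := by have := H 131321 (by norm_num); omega
  have h : n ≤ 18239 := by have := H 109433 (by norm_num); omega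
  have h : n ≤ 15200 := by have := H 91199 (by norm_num); omega
  have h : n ≤ 12667 := by have := H 76003 (by norm_num); omega
  have h : n ≤ 10556 := by have := H 63337 (by norm_num); omega
  have h : n ≤ 8799 := by have := H 52783 (by norm_num); omega
  have h : n ≤ 7334 := by have := H 43997 (by norm_num); omega
  have h : n ≤ 6111 := by have := H 36671 (by norm_num); omega
  have h : n ≤ 5094 := by have := H 30559 (by norm_num); omega
  have h : n ≤ 4249 := by have := H 25471 (by norm_num); omega
  have h : n ≤ 3541 := by have := H 21247 (by norm_num); omega
  have h : n ≤ 2951 := by have := H 17707 (by norm_num); omega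
  have h : n ≤ 2460 := by have := H 14759 (by norm_num); omega
  have h : n ≤ 2050 := by have := H 12301 (by norm_num); omega
  have h : n ≤ 1708 := by have := H 10253 (by norm_num); omega
  have h : n ≤ 1425 := by have := H 8543 (by norm_num); omega
  have h : n ≤ 1190 := by have := H 7129 (by norm_num); omega
  have h : n ≤ 993 := by have := H 5953 (by norm_num); omega
  have h : n ≤ 827 := by have := H 4967 (by norm_num); omega
  have h : n ≤ 689 := by have := H 4139 (by norm_num); omega
  have h : n ≤ 575 := by have := H 3449 (by norm_num); omega
  have h : n ≤ 479 := by have := H 2879 (by norm_num); omega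
  have h : n ≤ 400 := by have := H 2399 (by norm_num); omega
  have h : n ≤ 333 := by have := H 2003 (by norm_num); omega
  have h : n ≤ 281 := by have := H 1669 (by norm_num); omega
  have h : n ≤ 236 := by have := H 1409 (by norm_num); omega
  have h : n ≤ 196 := by have := H 1181 (by norm_num); omega
  have h : n ≤ 164 := by have := H 983 (by norm_num); omega
  have h : n ≤ 136 := by have := H 821 (by norm_num); omega
  have h : n ≤ 114 := by have := H 683 (by norm_num); omega
  have h : n ≤ 95 := by have := H 571 (by norm_num); omega
  have h : n ≤ 80 := by have := H 479 (by norm_num); omega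
  have h : n ≤ 67 := by have := H 401 (by norm_num); omega
  have h : n ≤ 56 := by have := H 337 (by norm_num); omega
  have h : n ≤ 46 := by have := H 281 (by norm_num); omega
  have h : n ≤ 38 := by have := H 233 (by norm_num); omega
  have h : n ≤ 31 := by have := H 191 (by norm_num); omega
  have h : n ≤ 26 := by have := H 157 (by norm_num); omega
  have h : n ≤ 21 := by have := H 131 (by norm_num); omega
  have h : n ≤ 17 := by have := H 107 (by norm_num); omega
  have h : n ≤ 14 := by have := H 89 (by norm_num); omega
  have h : n ≤ 12 := by have := H 73 (by norm_num); omega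
  have h : n ≤ 10 := by have := H 61 (by norm_num); omega
  have h : n ≤ 8 := by have := H 53 (by norm_num); omega
  have h : n ≤ 6 := by have := H 41 (by norm_num); omega
  have h : n ≤ 5 := by have := H 31 (by norm_num); omega
  have h : n ≤ 4 := by have := H 29 (by norm_num); omega
  have h : n ≤ 3 := by have := H 23 (by norm_num); omega
  have h : n ≤ 2 := by have := H 17 (by norm_num); omega
  have h : n ≤ 1 := by have := H 11 (by norm_num); omega
  have h : n ≤ 0 := by have := H 5 (by norm_num); omega
  omega

lemma log_fact_bounds (N : ℕ) (hN : 1 ≤ N) :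
    (N : ℝ) * Real.log N - N + 1 ≤ Real.log (N.factorial) ∧
    Real.log (N.factorial) ≤ ((N : ℝ) + 1) * Real.log N - N + 1 := by
  induction N, hN using Nat.le_induction with
  | base => simp
  | succ N hN ih =>
    have hN0 : (0 : ℝ) < N := by exact_mod_cast hN
    have e : Real.log ((N + 1).factorial) = Real.log ((N : ℝ) + 1) + Real.log (N.factorial) := by
      rw [Nat.factorial_succ]; push_cast
      rw [Real.log_mul (by positivity) (by positivity)]
    have h1 : Real.log ((N + 1 : ℝ) / N) ≤ (N + 1 : ℝ) / N - 1 :=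
      Real.log_le_sub_one_of_pos (by positivity)
    have h2 : 1 - ((N + 1 : ℝ) / N)⁻¹ ≤ Real.log ((N + 1 : ℝ) / N) :=
      Real.one_sub_inv_le_log_of_pos (by positivity)
    rw [Real.log_div (by positivity) (by positivity)] at h1 h2
    have h3 := mul_le_mul_of_nonneg_left h1 hN0.le
    have h4 := mul_le_mul_of_nonneg_left h2 (by positivity : (0 : ℝ) ≤ N + 1)
    have e3 : (N : ℝ) * ((N + 1 : ℝ) / N - 1) = 1 := by field_simp; ring
    have e4 : (N + 1 : ℝ) * (1 - ((N + 1 : ℝ) / N)⁻¹) = 1 := by field_simp; ring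
    rw [e3] at h3
    rw [e4] at h4
    rw [e]
    push_cast
    constructor <;> nlinarith [ih.1, ih.2]

lemma log_le_two_sqrt (x : ℝ) (hx : 0 < x) : Real.log x ≤ 2 * √x - 2 := by
  have h := Real.log_le_sub_one_of_pos (Real.sqrt_pos.mpr hx)
  rw [Real.log_sqrt hx.le] at h
  linarith

lemma g_mono (a b : ℝ) (ha : 1 ≤ a) (hab : a ≤ b) :
    a * Real.log a - a ≤ b * Real.log b - b := by
  have ha0 : 0 < a := by linarith
  have hb0 : 0 < b := by linarith
  have h := Real.one_sub_inv_le_log_of_pos (div_pos hb0 ha0)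
  rw [Real.log_div hb0.ne' ha0.ne'] at h
  have h2 := mul_le_mul_of_nonneg_left h hb0.le
  have e : b * (1 - (b / a)⁻¹) = b - a := by field_simp
  rw [e] at h2
  nlinarith [Real.log_nonneg ha]

lemma T_bound (x : ℝ) (hx : 0 < x) :
    |Real.log ((⌊x⌋₊).factorial) - (x * Real.log x - x)| ≤ 2 * √x := by
  have hs := Real.sqrt_pos.mpr hx
  have hss := Real.sq_sqrt hx.le
  rcases lt_or_ge x 1 with h1 | h1
  · have : ⌊x⌋₊ = 0 := Nat.floor_eq_zero.mpr h1
    rw [this]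
    have hl := Real.log_neg hx h1
    have h2 := Real.one_sub_inv_le_log_of_pos hs
    rw [Real.log_sqrt hx.le] at h2
    have h3 := mul_le_mul_of_nonneg_left h2 hx.le
    have e : x * (1 - (√x)⁻¹) = x - √x := by
      have : x * (√x)⁻¹ = √x := by
        nth_rewrite 1 [← hss]; field_simp
      rw [mul_sub, this, mul_one]
    rw [e] at h3
    simp only [Nat.factorial_zero, Nat.cast_one, Real.log_one]
    rw [abs_le]
    constructor <;> nlinarith
  · set N := ⌊x⌋₊ with hN
    have hN1 : 1 ≤ N := Nat.le_floor (by simpa using h1)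
    have hNx : (N : ℝ) ≤ x := Nat.floor_le hx.le
    have hxN : x < N + 1 := Nat.lt_floor_add_one x
    have hN1' : (1 : ℝ) ≤ N := by exact_mod_cast hN1
    have hb := (log_fact_bounds N hN1).2
    have hc := (log_fact_bounds (N + 1) (by omega)).1
    have e : Real.log ((N + 1).factorial) = Real.log ((N : ℝ) + 1) + Real.log (N.factorial) := by
      rw [Nat.factorial_succ]; push_cast
      rw [Real.log_mul (by positivity) (by positivity)]
    rw [e] at hc
    push_cast at hc
    have g1 := g_mono N x hN1' hNx
    have g2 := g_mono x (N + 1) h1 hxN.le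
    have l1 : Real.log N ≤ Real.log x := Real.log_le_log (by linarith) hNx
    have l2 : Real.log ((N : ℝ) + 1) ≤ Real.log (2 * x) :=
      Real.log_le_log (by linarith) (by linarith)
    rw [Real.log_mul (by norm_num) hx.ne'] at l2
    have l3 := log_le_two_sqrt x hx
    have l4 := Real.log_two_lt_d9
    rw [abs_le]
    constructor <;> linarith

lemma log_fact_eq (N M : ℕ) (h : N ≤ M) :
    Real.log (N.factorial) = ∑ d ∈ Finset.Ioc 0 M, Λ d * ((N / d : ℕ) : ℝ) := by
  induction N with
  | zero => simp
  | succ N ih =>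
    have e : Real.log ((N + 1).factorial)
        = Real.log ((N + 1 : ℕ) : ℝ) + Real.log (N.factorial) := by
      rw [Nat.factorial_succ]; push_cast
      rw [Real.log_mul (by positivity) (by positivity)]
    rw [e, ih (by omega), ← vonMangoldt_sum]
    have e2 : (N + 1).divisors = (Finset.Ioc 0 M).filter (fun d => d ∣ N + 1) := by
      ext d
      simp only [Nat.mem_divisors, Finset.mem_filter, Finset.mem_Ioc]
      constructor
      · rintro ⟨h1, -⟩
        exact ⟨⟨Nat.pos_of_dvd_of_pos h1 (by omega), (Nat.le_of_dvd (by omega) h1).trans h⟩, h1⟩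
      · rintro ⟨-, h1⟩
        exact ⟨h1, by omega⟩
    rw [e2, Finset.sum_filter, ← Finset.sum_add_distrib]
    refine Finset.sum_congr rfl fun d _ => ?_
    rw [Nat.succ_div]
    split_ifs <;> push_cast <;> ring

lemma psi_eq_ite (N k : ℕ) (hk : 0 < k) :
    psi ((N / k : ℕ) : ℝ) = ∑ d ∈ Finset.Ioc 0 N, Λ d * (if k ≤ N / d then 1 else 0) := by
  unfold psi
  rw [Nat.floor_natCast]
  have e : Finset.Ioc 0 (N / k) = (Finset.Ioc 0 N).filter (fun d => k ≤ N / d) := by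
    ext d
    simp only [Finset.mem_filter, Finset.mem_Ioc]
    constructor
    · rintro ⟨h0, h1⟩
      refine ⟨⟨h0, h1.trans (Nat.div_le_self _ _)⟩, ?_⟩
      rw [Nat.le_div_iff_mul_le h0]
      rw [Nat.le_div_iff_mul_le hk] at h1
      linarith
    · rintro ⟨⟨h0, -⟩, h1⟩
      refine ⟨h0, ?_⟩
      rw [Nat.le_div_iff_mul_le hk]
      rw [Nat.le_div_iff_mul_le h0] at h1
      linarith
  rw [e, Finset.sum_filter]
  refine Finset.sum_congr rfl fun d _ => ?_
  split_ifs <;> simp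

/-- The Chebyshev combination. -/
noncomputable def chebS (N : ℕ) : ℝ :=
  Real.log (N.factorial) - Real.log ((N / 2).factorial) - Real.log ((N / 3).factorial)
    - Real.log ((N / 5).factorial) + Real.log ((N / 30).factorial)

lemma chebS_eq (N : ℕ) : chebS N = ∑ d ∈ Finset.Ioc 0 N, Λ d *
    (((N / d : ℕ) : ℝ) - ((N / d / 2 : ℕ) : ℝ) - ((N / d / 3 : ℕ) : ℝ)
      - ((N / d / 5 : ℕ) : ℝ) + ((N / d / 30 : ℕ) : ℝ)) := by
  unfold chebS
  rw [log_fact_eq N N le_rfl, log_fact_eq (N / 2) N (Nat.div_le_self _ _),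
    log_fact_eq (N / 3) N (Nat.div_le_self _ _), log_fact_eq (N / 5) N (Nat.div_le_self _ _),
    log_fact_eq (N / 30) N (Nat.div_le_self _ _), ← Finset.sum_sub_distrib,
    ← Finset.sum_sub_distrib, ← Finset.sum_sub_distrib, ← Finset.sum_add_distrib]
  refine Finset.sum_congr rfl fun d _ => ?_
  simp only [Nat.div_right_comm N _ d]
  ring

lemma chebS_le_psi (N : ℕ) : chebS N ≤ psi N := by
  have h := psi_eq_ite N 1 one_pos
  rw [Nat.div_one] at h
  rw [h, chebS_eq]
  refine Finset.sum_le_sum fun d _ => mul_le_mul_of_nonneg_left ?_ vonMangoldt_nonneg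
  generalize N / d = k
  have : k + k / 30 ≤ (if 1 ≤ k then 1 else 0) + k / 2 + k / 3 + k / 5 := by
    split_ifs <;> omega
  have h2 : ((k + k / 30 : ℕ) : ℝ) ≤
    (((if 1 ≤ k then 1 else 0) + k / 2 + k / 3 + k / 5 : ℕ) : ℝ) := by exact_mod_cast this
  rw [Nat.cast_add, Nat.cast_add, Nat.cast_add, Nat.cast_add] at h2
  push_cast at h2 ⊢
  linarith

lemma psi_le_chebS (N : ℕ) : psi N + psi ((N / 7 : ℕ) : ℝ) ≤
    chebS N + psi ((N / 6 : ℕ) : ℝ) + psi ((N / 10 : ℕ) : ℝ) := by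
  have h := psi_eq_ite N 1 one_pos
  rw [Nat.div_one] at h
  rw [h, chebS_eq, psi_eq_ite N 7 (by norm_num), psi_eq_ite N 6 (by norm_num),
    psi_eq_ite N 10 (by norm_num), ← Finset.sum_add_distrib, ← Finset.sum_add_distrib,
    ← Finset.sum_add_distrib]
  refine Finset.sum_le_sum fun d _ => ?_
  rw [← mul_add, ← mul_add, ← mul_add]
  refine mul_le_mul_of_nonneg_left ?_ vonMangoldt_nonneg
  generalize N / d = k
  have : (if 1 ≤ k then 1 else 0) + (if 7 ≤ k then 1 else 0) + k / 2 + k / 3 + k / 5 ≤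
      k + k / 30 + (if 6 ≤ k then 1 else 0) + (if 10 ≤ k then 1 else 0) := by
    split_ifs <;> omega
  have h2 : (((if 1 ≤ k then 1 else 0) + (if 7 ≤ k then 1 else 0) + k / 2 + k / 3 + k / 5 : ℕ) : ℝ)
      ≤ ((k + k / 30 + (if 6 ≤ k then 1 else 0) + (if 10 ≤ k then 1 else 0) : ℕ) : ℝ) := by
    exact_mod_cast this
  rw [Nat.cast_add, Nat.cast_add, Nat.cast_add, Nat.cast_add, Nat.cast_add, Nat.cast_add,
    Nat.cast_add] at h2
  push_cast at h2 ⊢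
  linarith

lemma sqrt_div_le (x k c : ℝ) (hx : 0 ≤ x) (hc : 0 ≤ c) (hk : 1 / k ≤ c ^ 2) :
    √(x / k) ≤ c * √x := by
  apply Real.sqrt_le_iff.mpr
  refine ⟨by positivity, ?_⟩
  rw [mul_pow, Real.sq_sqrt hx]
  calc x / k = 1 / k * x := by ring
    _ ≤ _ := mul_le_mul_of_nonneg_right hk hx

/-- Chebyshev's constant. -/
noncomputable def chebA : ℝ :=
  Real.log 2 / 2 + Real.log 3 / 3 + Real.log 5 / 5 - Real.log 30 / 30

lemma chebA_ge : (0.76 : ℝ) ≤ chebA := by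
  unfold chebA
  have h30 : Real.log 30 = Real.log 2 + Real.log 3 + Real.log 5 := by
    rw [← Real.log_mul (by norm_num) (by norm_num), ← Real.log_mul (by norm_num) (by norm_num)]
    norm_num
  have h3 : Real.log 2 ≤ Real.log 3 := Real.log_le_log (by norm_num) (by norm_num)
  have h4 : Real.log 4 = Real.log 2 + Real.log 2 := by
    rw [← Real.log_mul (by norm_num) (by norm_num)]
    norm_num
  have h5 : Real.log 4 ≤ Real.log 5 := Real.log_le_log (by norm_num) (by norm_num)
  have := Real.log_two_gt_d9
  rw [h30]
  linarith

lemma chebS_bound (x : ℝ) (hx : 0 < x) : |chebS ⌊x⌋₊ - chebA * x| ≤ 6 * √x := by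
  have h1 := T_bound x hx
  have h2 := T_bound (x / 2) (by positivity)
  have h3 := T_bound (x / 3) (by positivity)
  have h5 := T_bound (x / 5) (by positivity)
  have h30 := T_bound (x / 30) (by positivity)
  have f2 : ⌊x / 2⌋₊ = ⌊x⌋₊ / 2 := by exact_mod_cast Nat.floor_div_natCast x 2
  have f3 : ⌊x / 3⌋₊ = ⌊x⌋₊ / 3 := by exact_mod_cast Nat.floor_div_natCast x 3
  have f5 : ⌊x / 5⌋₊ = ⌊x⌋₊ / 5 := by exact_mod_cast Nat.floor_div_natCast x 5
  have f30 : ⌊x / 30⌋₊ = ⌊x⌋₊ / 30 := by exact_mod_cast Nat.floor_div_natCast x 30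
  rw [f2, Real.log_div hx.ne' (by norm_num)] at h2
  rw [f3, Real.log_div hx.ne' (by norm_num)] at h3
  rw [f5, Real.log_div hx.ne' (by norm_num)] at h5
  rw [f30, Real.log_div hx.ne' (by norm_num)] at h30
  have s2 := sqrt_div_le x 2 0.7072 hx.le (by norm_num) (by norm_num)
  have s3 := sqrt_div_le x 3 0.5774 hx.le (by norm_num) (by norm_num)
  have s5 := sqrt_div_le x 5 0.4473 hx.le (by norm_num) (by norm_num)
  have s30 := sqrt_div_le x 30 0.1826 hx.le (by norm_num) (by norm_num)
  have hs := Real.sqrt_nonneg x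
  unfold chebS chebA
  rw [abs_le] at *
  obtain ⟨a1, b1⟩ := h1
  obtain ⟨a2, b2⟩ := h2
  obtain ⟨a3, b3⟩ := h3
  obtain ⟨a5, b5⟩ := h5
  obtain ⟨a30, b30⟩ := h30
  constructor <;> nlinarith

lemma psi_lower (x : ℝ) (hx : 0 < x) : chebA * x - 6 * √x ≤ psi x := by
  rw [psi_eq_psi_coe_floor]
  linarith [(abs_le.mp (chebS_bound x hx)).1, chebS_le_psi ⌊x⌋₊]

lemma psi_upper (N : ℕ) : psi N ≤ chebA * (90 / 77) * N + 31 * √(N : ℝ) := by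
  induction N using Nat.strong_induction_on with
  | _ N ih =>
  rcases Nat.eq_zero_or_pos N with rfl | hN
  · simp
  have hx : (0 : ℝ) < N := by exact_mod_cast hN
  have hA := chebA_ge
  have key := psi_le_chebS N
  have hS := (abs_le.mp (chebS_bound N hx)).2
  rw [Nat.floor_natCast] at hS
  have i6 := ih (N / 6) (by omega)
  have i10 := ih (N / 10) (by omega)
  have c6 : ((N / 6 : ℕ) : ℝ) ≤ (N : ℝ) / 6 := by exact_mod_cast Nat.cast_div_le (α := ℝ)
  have c10 : ((N / 10 : ℕ) : ℝ) ≤ (N : ℝ) / 10 := by exact_mod_cast Nat.cast_div_le (α := ℝ)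
  have m6 := mul_le_mul_of_nonneg_left c6 (by positivity : 0 ≤ chebA * (90 / 77))
  have m10 := mul_le_mul_of_nonneg_left c10 (by positivity : 0 ≤ chebA * (90 / 77))
  have r6 := Real.sqrt_le_sqrt c6
  have r10 := Real.sqrt_le_sqrt c10
  have s6 := sqrt_div_le N 6 0.4083 hx.le (by norm_num) (by norm_num)
  have s10 := sqrt_div_le N 10 0.3163 hx.le (by norm_num) (by norm_num)
  have s7 := sqrt_div_le N 7 0.378 hx.le (by norm_num) (by norm_num)
  have l7 := psi_lower ((N : ℝ) / 7) (by positivity)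
  have f7 : ⌊(N : ℝ) / 7⌋₊ = N / 7 := by
    have := Nat.floor_div_natCast (N : ℝ) 7
    rw [Nat.floor_natCast] at this
    exact_mod_cast this
  rw [psi_eq_psi_coe_floor, f7] at l7
  have hs := Real.sqrt_nonneg (N : ℝ)
  nlinarith

lemma large_case (n : ℕ) (h : 2 ^ 22 ≤ n) :
    ∃ p : ℕ, p.Prime ∧ 5 * n ≤ p ∧ p ≤ 6 * n := by
  by_contra hcon
  have H : ∀ p : ℕ, p.Prime → ¬ (5 * n ≤ p ∧ p ≤ 6 * n) := fun p hp hh => hcon ⟨p, hp, hh⟩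
  have hθ : theta ((6 * n : ℕ) : ℝ) = theta ((5 * n : ℕ) : ℝ) := by
    unfold theta
    rw [Nat.floor_natCast, Nat.floor_natCast]
    congr 1
    ext p
    simp only [Finset.mem_filter, Finset.mem_Ioc]
    constructor
    · rintro ⟨⟨h0, h1⟩, hp⟩
      have := H p hp
      exact ⟨⟨h0, by omega⟩, hp⟩
    · rintro ⟨⟨h0, h1⟩, hp⟩
      exact ⟨⟨h0, by omega⟩, hp⟩
  have hn : (2 ^ 22 : ℝ) ≤ n := by exact_mod_cast h
  have hn0 : (0 : ℝ) < n := by linarith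
  have hu := psi_upper (5 * n)
  have hl := psi_lower ((6 * n : ℕ) : ℝ) (by push_cast; positivity)
  have ht := theta_le_psi ((5 * n : ℕ) : ℝ)
  have hd := psi_sub_theta_le (x := ((6 * n : ℕ) : ℝ)) (by push_cast; linarith)
  push_cast at *
  set s := √(n : ℝ) with hs
  have hss : s ^ 2 = n := Real.sq_sqrt hn0.le
  have hs0 : 0 ≤ s := Real.sqrt_nonneg _
  have hs1 : (2048 : ℝ) ≤ s := Real.le_sqrt_of_sq_le (by linarith)
  have r6 : √(6 * (n : ℝ)) ≤ 2.45 * s := by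
    apply Real.sqrt_le_iff.mpr
    constructor
    · positivity
    · nlinarith
  have r5 : √(5 * (n : ℝ)) ≤ 2.2361 * s := by
    apply Real.sqrt_le_iff.mpr
    constructor
    · positivity
    · nlinarith
  have hlog : Real.log (6 * n) ≤ 16 + s / 1024 := by
    have e1 : Real.log (s / 2048) ≤ s / 2048 - 1 := Real.log_le_sub_one_of_pos (by positivity)
    have e2 : (6 * n : ℝ) = 6 * 2 ^ 22 * (s / 2048) ^ 2 := by rw [← hss]; ring
    have e3 : Real.log 6 ≤ Real.log (2 ^ 3) := Real.log_le_log (by norm_num) (by norm_num)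
    rw [e2, Real.log_mul (by norm_num) (by positivity), Real.log_mul (by norm_num) (by norm_num),
      Real.log_pow, Real.log_pow]
    rw [Real.log_pow] at e3
    have := Real.log_two_lt_d9
    push_cast at *
    linarith
  have hlog0 : 0 ≤ Real.log (6 * n) := Real.log_nonneg (by linarith)
  have hm : √(6 * (n : ℝ)) * Real.log (6 * n) ≤ 2.45 * s * (16 + s / 1024) :=
    mul_le_mul r6 hlog hlog0 (by positivity)
  have hA := mul_le_mul_of_nonneg_right chebA_ge hn0.le
  nlinarith

theorem exists_prime_in_Icc_five_six (n : ℕ) (hn : 0 < n) :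
    ∃ p : ℕ, p.Prime ∧ 5 * n ≤ p ∧ p ≤ 6 * n := by
  rcases lt_or_ge n (2 ^ 22) with h | h
  · exact small_case n hn h
  · exact large_case n h
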